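/- Let S be a monoid and A a co-uniform right S-act. Then either A is indecomposable, or A is the union of two disjoint subacts A₁ and A₂ each of which is simple; moreover, no decomposition of A into more than two disjoint indecomposable subacts exists. -/

import Mathlib

variable {S : Type*} [Monoid S] {A : Type*}

/-- A subact of a right `S`-act: a nonempty subset closed under the action. -/
def IsSubact (act : A → S → A) (B : Set A) : Prop :=
  B.Nonempty ∧ ∀ b ∈ B, ∀ s : S, act b s ∈ B

/-- `C` is superfluous in the whole act `A`: its union with any proper subact is proper. -/
def Superfluous (act : A → S → A) (C : Set A) : Prop :=
  ∀ D : Set A, IsSubact act D → D ≠ Set.univ → C ∪ D ≠ Set.univ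

/-- `C` is superfluous in the subact `B` (viewed as a right `S`-act in its own right). -/
def SuperfluousIn (act : A → S → A) (C B : Set A) : Prop :=
  ∀ D : Set A, IsSubact act D → D ⊆ B → D ≠ B → C ∪ D ≠ B

/-- `C` is coessential in `A`: for every proper subact `D` meeting `C`, `C ∪ D ≠ A`. -/
def Coessential (act : A → S → A) (C : Set A) : Prop :=
  ∀ D : Set A, IsSubact act D → D ≠ Set.univ → (C ∩ D).Nonempty → C ∪ D ≠ Set.univ

/-- The act `A` is indecomposable: not a union of two disjoint subacts. -/
def IndecomposableAct (act : A → S → A) : Prop :=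
  ¬ ∃ B C : Set A, IsSubact act B ∧ IsSubact act C ∧ B ∩ C = ∅ ∧ B ∪ C = Set.univ

/-- The subact `B` is indecomposable as an act in its own right. -/
def IndecompIn (act : A → S → A) (B : Set A) : Prop :=
  ¬ ∃ C D : Set A, IsSubact act C ∧ IsSubact act D ∧ C ⊆ B ∧ D ⊆ B ∧
      C ∩ D = ∅ ∧ C ∪ D = B

/-- The act `A` is simple: it has no proper subacts. -/
def SimpleAct (act : A → S → A) : Prop :=
  ∀ B : Set A, IsSubact act B → B = Set.univ

/-- The subact `B` is simple as an act in its own right. -/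
def SimpleIn (act : A → S → A) (B : Set A) : Prop :=
  ∀ C : Set A, IsSubact act C → C ⊆ B → C = B

/-- The act `A` is hollow: every proper subact is superfluous. -/
def Hollow (act : A → S → A) : Prop :=
  ∀ B : Set A, IsSubact act B → B ≠ Set.univ → Superfluous act B

/-- The subact `B` is hollow as an act in its own right. -/
def HollowIn (act : A → S → A) (B : Set A) : Prop :=
  ∀ C : Set A, IsSubact act C → C ⊆ B → C ≠ B → SuperfluousIn act C B

/-- The act `A` is co-uniform: every proper subact is coessential. -/
def CoUniform (act : A → S → A) : Prop :=
  ∀ B : Set A, IsSubact act B → B ≠ Set.univ → Coessential act B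

/-- The act `A` is cyclic: `A = aS` for some `a`. -/
def Cyclic (act : A → S → A) : Prop :=
  ∃ a : A, Set.range (act a) = Set.univ

/-- The act `A` is locally cyclic. -/
def LocallyCyclic (act : A → S → A) : Prop :=
  ∀ a a' : A, ∃ a'' : A, a ∈ Set.range (act a'') ∧ a' ∈ Set.range (act a'')

/-- The set `G` generates the act `A`. -/
def Generates (act : A → S → A) (G : Set A) : Prop :=
  (⋃ g ∈ G, Set.range (act g)) = Set.univ

/-- The act `A` is finitely generated. -/
def FinGen (act : A → S → A) : Prop :=
  ∃ F : Finset A, (⋃ a ∈ F, Set.range (act a)) = Set.univ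

/-- `M` is a maximal subact of `A`: a proper subact such that the only subact
strictly containing it is `A` itself. -/
def IsMaxSubact (act : A → S → A) (M : Set A) : Prop :=
  IsSubact act M ∧ M ≠ Set.univ ∧ ∀ C : Set A, IsSubact act C → M ⊂ C → C = Set.univ

/-- The act `A` is local: it has exactly one maximal subact. -/
def LocalAct (act : A → S → A) : Prop :=
  ∃! M : Set A, IsMaxSubact act M

/-- The radical of `A`: the intersection of all maximal subacts
(`= A` when there is no maximal subact, since `⋂₀ ∅ = Set.univ`). -/
def RadAct (act : A → S → A) : Set A :=
  ⋂₀ {M : Set A | IsMaxSubact act M}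

/-- `C` is a supplement of `B` in `A`. -/
def IsSupplement (act : A → S → A) (B C : Set A) : Prop :=
  IsSubact act C ∧ B ∪ C = Set.univ ∧
    ∀ D : Set A, IsSubact act D → D ⊆ C → B ∪ D = Set.univ → D = C

/-- The act `A` is supplemented: every proper subact has a supplement. -/
def Supplemented (act : A → S → A) : Prop :=
  ∀ B : Set A, IsSubact act B → B ≠ Set.univ → ∃ C : Set A, IsSupplement act B C

theorem IsSubact.union {T X : Type*} {act : X → T → X} {B C : Set X}
    (hB : IsSubact act B) (hC : IsSubact act C) : IsSubact act (B ∪ C) :=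
  ⟨hB.1.inl, fun b hb s => hb.imp (fun hb => hB.2 b hb s) (fun hb => hC.2 b hb s)⟩

/-- In a co-uniform act, a subact with a complementary subact is simple. -/
theorem CoUniform.simpleIn_of_disjoint_union {T X : Type*} {act : X → T → X} (h : CoUniform act)
    {B C : Set X} (hB : IsSubact act B) (hC : IsSubact act C)
    (hdisj : B ∩ C = ∅) (hunion : B ∪ C = Set.univ) : SimpleIn act B := by
  intro D hD hDB
  by_contra hne
  obtain ⟨c, hc⟩ := hC.1
  obtain ⟨d, hd⟩ := hD.1
  obtain ⟨b, hbB, hbD⟩ := Set.exists_of_ssubset (hDB.ssubset_of_ne hne)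
  have hBproper : B ≠ Set.univ := fun heq =>
    Set.eq_empty_iff_forall_notMem.mp hdisj c ⟨heq ▸ Set.mem_univ c, hc⟩
  have hDCproper : D ∪ C ≠ Set.univ := by
    intro heq
    have hb : b ∈ D ∪ C := heq ▸ Set.mem_univ b
    exact hb.elim hbD fun hbC => Set.eq_empty_iff_forall_notMem.mp hdisj b ⟨hbB, hbC⟩
  refine h B hB hBproper (D ∪ C) (hD.union hC) hDCproper ⟨d, hDB hd, Or.inl hd⟩ ?_
  rw [← Set.union_assoc, Set.union_eq_self_of_subset_right hDB, hunion]

/-- a co-uniform act is indecomposable or the disjoint union of two simple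
subacts; moreover it admits no decomposition into more than two disjoint indecomposable
subacts. -/
theorem coUniform_structure
    (act : A → S → A) [Nonempty A]
    (hone : ∀ a : A, act a 1 = a)
    (hmul : ∀ (a : A) (s t : S), act a (s * t) = act (act a s) t)
    (h : CoUniform act) :
    (IndecomposableAct act ∨
      ∃ A₁ A₂ : Set A, IsSubact act A₁ ∧ IsSubact act A₂ ∧ A₁ ∩ A₂ = ∅ ∧
        A₁ ∪ A₂ = Set.univ ∧ SimpleIn act A₁ ∧ SimpleIn act A₂) ∧
    ∀ (ι : Type*) (F : ι → Set A),
      (∀ i, IsSubact act (F i)) → (∀ i, IndecompIn act (F i)) →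
      (∀ i j, i ≠ j → F i ∩ F j = ∅) → (⋃ i, F i) = Set.univ →
      ∀ i j k : ι, i ≠ j → i ≠ k → j ≠ k → False := by
  refine ⟨or_iff_not_imp_left.mpr fun hdec => ?_, ?_⟩
  · obtain ⟨B, C, hB, hC, hdisj, hunion⟩ := not_not.mp hdec
    exact ⟨B, C, hB, hC, hdisj, hunion, h.simpleIn_of_disjoint_union hB hC hdisj hunion,
      h.simpleIn_of_disjoint_union hC hB (Set.inter_comm B C ▸ hdisj)
        (Set.union_comm B C ▸ hunion)⟩
  · intro ι F hF _ hdisj hunion i j k hij hik hjk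
    have hsub : ∀ l, l ≠ i → F l ⊆ ⋃ m ∈ {m | m ≠ i}, F m := fun l hl =>
      Set.subset_biUnion_of_mem (u := F) hl
    have hrest : IsSubact act (⋃ m ∈ {m | m ≠ i}, F m) := by
      refine ⟨(hF j).1.mono (hsub j hij.symm), fun a ha s => ?_⟩
      obtain ⟨l, hl, hal⟩ := Set.mem_iUnion₂.mp ha
      exact hsub l hl ((hF l).2 a hal s)
    have hsimple : SimpleIn act (⋃ m ∈ {m | m ≠ i}, F m) := by
      refine h.simpleIn_of_disjoint_union hrest (hF i) ?_ ?_
      · refine Set.eq_empty_iff_forall_notMem.mpr fun a ⟨ha, hai⟩ => ?_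
        obtain ⟨l, hl, hal⟩ := Set.mem_iUnion₂.mp ha
        exact Set.eq_empty_iff_forall_notMem.mp (hdisj l i hl) a ⟨hal, hai⟩
      · refine Set.eq_univ_of_forall fun a => ?_
        obtain ⟨l, hal⟩ := Set.mem_iUnion.mp (hunion ▸ Set.mem_univ a)
        by_cases hl : l = i
        · exact Or.inr (hl ▸ hal)
        · exact Or.inl (hsub l hl hal)
    obtain ⟨a, ha⟩ := (hF k).1
    have haj : a ∈ F j := hsimple (F j) (hF j) (hsub j hij.symm) ▸ hsub k hik.symm ha
    exact Set.eq_empty_iff_forall_notMem.mp (hdisj j k hjk) a ⟨haj, ha⟩
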